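/- In the sequence JSCC setup with SPO hypothesis, let Dₙ = dₙ(Sₙ, gₙ(Yₙ)) and suppose E[Dₙ] = μ for all n, where 0 < μ < ∞, and suppose there exist τ₁ > 0 and ε₁ > 0 such that P(Dₙ > μ + τ₁) > ε₁ for every n. Then there exist τ ∈ (0, μ) and ε > 0 such that for every γ > 0, liminf_{n→∞} P(iₙ(Sₙ, Yₙ) ≤ R(μ − τ) − γ) ≤ 1 − ε. -/

import Mathlib

open scoped BigOperators
open Filter

/-- Probability of an event under a PMF on a finite type. -/
noncomputable def srcPr {S : Type*} [Fintype S] (p : PMF S) (E : Set S) : ℝ :=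
  ∑ s, E.indicator (fun s => (p s).toReal) s

/-- Probability of an event for the joint law `P(s, y) = p(s) · W(e(s))(y)`
of the source and the channel output. -/
noncomputable def jointPr {S X Y : Type*} [Fintype S] [Fintype Y]
    (p : PMF S) (W : X → PMF Y) (e : S → X) (E : Set (S × Y)) : ℝ :=
  ∑ s, ∑ y, E.indicator (fun sy => (p sy.1 * W (e sy.1) sy.2).toReal) (s, y)

/-- The output marginal `q(y) = ∑ s, p(s) · W(e(s))(y)`. -/
noncomputable def outQ {S X Y : Type*} [Fintype S]
    (p : PMF S) (W : X → PMF Y) (e : S → X) (y : Y) : ℝ :=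
  ∑ s, (p s * W (e s) y).toReal

/-- The normalized information density `i(s; y) = (1/n) log₂ (W(e(s))(y) / q(y))`. -/
noncomputable def infoDensity {S X Y : Type*} [Fintype S]
    (n : ℕ) (p : PMF S) (W : X → PMF Y) (e : S → X) (s : S) (y : Y) : ℝ :=
  (1 / (n : ℝ)) * Real.logb 2 ((W (e s) y).toReal / outQ p W e y)

/-- Expectation of the distortion `d(S, g(Y))` under the joint law
`P(s, y) = p(s) · W(e(s))(y)`. -/
noncomputable def jointExp {S X Y Sh : Type*} [Fintype S] [Fintype Y]
    (p : PMF S) (W : X → PMF Y) (e : S → X) (g : Y → Sh) (d : S → Sh → ℝ) : ℝ :=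
  ∑ s, ∑ y, (p s * W (e s) y).toReal * d s (g y)

lemma PMF.sum_toReal_eq_one {α : Type*} [Fintype α] (p : PMF α) : ∑ a, (p a).toReal = 1 := by
  rw [← ENNReal.toReal_sum (fun a _ => p.apply_ne_top a), ← tsum_fintype (L := .unconditional α),
    p.tsum_coe, ENNReal.toReal_one]

section JointLaw

variable {S X Y Sh : Type*} [Fintype S]
  (p : PMF S) (W : X → PMF Y) (e : S → X)

lemma outQ_nonneg (y : Y) : 0 ≤ outQ p W e y :=
  Finset.sum_nonneg fun _ _ => ENNReal.toReal_nonneg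

lemma joint_le_outQ (s : S) (y : Y) : (p s * W (e s) y).toReal ≤ outQ p W e y :=
  Finset.single_le_sum (f := fun s => (p s * W (e s) y).toReal)
    (fun _ _ => ENNReal.toReal_nonneg) (Finset.mem_univ s)

/-- The joint mass of a pair with small information density is controlled by the product law. -/
lemma joint_le_of_infoDensity_le {n : ℕ} (hn : 1 ≤ n) {r : ℝ} {s : S} {y : Y}
    (h : infoDensity n p W e s y ≤ r) :
    (p s * W (e s) y).toReal ≤ (p s).toReal * (outQ p W e y * 2 ^ ((n : ℝ) * r)) := by
  have hn' : (0 : ℝ) < n := by exact_mod_cast hn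
  have hq := outQ_nonneg p W e y
  have hle := joint_le_outQ p W e s y
  rcases (ENNReal.toReal_nonneg (a := p s * W (e s) y)).eq_or_lt with h0 | h0
  · rw [← h0]
    have := ENNReal.toReal_nonneg (a := p s)
    positivity
  · have hq' : 0 < outQ p W e y := h0.trans_le hle
    rw [ENNReal.toReal_mul] at h0 ⊢
    have hW : 0 < (W (e s) y).toReal := pos_of_mul_pos_right h0 ENNReal.toReal_nonneg
    refine mul_le_mul_of_nonneg_left ?_ ENNReal.toReal_nonneg
    unfold infoDensity at h
    have hlog : Real.logb 2 ((W (e s) y).toReal / outQ p W e y) ≤ n * r := by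
      rwa [one_div, inv_mul_le_iff₀ hn'] at h
    rw [Real.logb_le_iff_le_rpow one_lt_two (div_pos hW hq'), div_le_iff₀ hq'] at hlog
    linarith

variable [Fintype Y]

lemma sum_joint_eq_one : ∑ s, ∑ y, (p s * W (e s) y).toReal = 1 := by
  simp [ENNReal.toReal_mul, ← Finset.mul_sum, PMF.sum_toReal_eq_one]

lemma sum_outQ_eq_one : ∑ y, outQ p W e y = 1 := by
  unfold outQ
  rw [Finset.sum_comm]
  exact sum_joint_eq_one p W e

lemma jointPr_nonneg (E : Set (S × Y)) : 0 ≤ jointPr p W e E :=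
  Finset.sum_nonneg fun _ _ => Finset.sum_nonneg fun _ _ =>
    Set.indicator_nonneg (fun _ _ => ENNReal.toReal_nonneg) _

lemma srcPr_eq_sum_joint (E : Set S) :
    srcPr p E = ∑ s, ∑ y, E.indicator (fun s => (p s).toReal) s * (W (e s) y).toReal := by
  simp [srcPr, ← Finset.mul_sum, PMF.sum_toReal_eq_one]

/-- A two-threshold form of Markov's inequality for the distortion. -/
lemma two_threshold_le_jointExp (g : Y → Sh) (d : S → Sh → ℝ) (hd : ∀ s sh, 0 ≤ d s sh)
    {u v : ℝ} (huv : u ≤ v) :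
    u * (1 - jointPr p W e {sy | d sy.1 (g sy.2) ≤ u})
      + (v - u) * jointPr p W e {sy | v < d sy.1 (g sy.2)} ≤ jointExp p W e g d := by
  rw [← sum_joint_eq_one p W e]
  unfold jointPr jointExp
  simp only [← Finset.sum_sub_distrib, Finset.mul_sum, ← Finset.sum_add_distrib]
  refine Finset.sum_le_sum fun s _ => Finset.sum_le_sum fun y _ => ?_
  classical
  have hw : 0 ≤ (p s * W (e s) y).toReal := ENNReal.toReal_nonneg
  have hdw := mul_nonneg hw (hd s (g y))
  simp only [Set.indicator_apply, Set.mem_ofPred_eq]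
  generalize (p s * W (e s) y).toReal = w at *
  split_ifs with h₁ h₂ h₂
  · linarith
  · linarith
  · nlinarith
  · nlinarith

/-- One-shot bound: small information density forces large distortion, an atypical source
symbol, or an event whose probability is bounded by a change of measure to the product law. -/
lemma jointPr_infoDensity_le (g : Y → Sh) (d : S → Sh → ℝ) (A : Set S) {n : ℕ} (hn : 1 ≤ n)
    {r α M : ℝ} (hM : ∀ sh, srcPr p {s | s ∈ A ∧ d s sh ≤ α} ≤ M) :
    jointPr p W e {sy | infoDensity n p W e sy.1 sy.2 ≤ r}
      ≤ 1 - jointPr p W e {sy | d sy.1 (g sy.2) ≤ α} + srcPr p Aᶜ + 2 ^ ((n : ℝ) * r) * M := by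
  have hprod : ∑ s, ∑ y, {s | s ∈ A ∧ d s (g y) ≤ α}.indicator (fun s => (p s).toReal) s
      * (outQ p W e y * 2 ^ ((n : ℝ) * r)) ≤ 2 ^ ((n : ℝ) * r) * M := by
    rw [Finset.sum_comm]
    calc _ ≤ ∑ y, M * (outQ p W e y * 2 ^ ((n : ℝ) * r)) := by
          refine Finset.sum_le_sum fun y _ => ?_
          rw [← Finset.sum_mul]
          exact mul_le_mul_of_nonneg_right (hM (g y))
            (mul_nonneg (outQ_nonneg p W e y) (by positivity))
      _ = 2 ^ ((n : ℝ) * r) * M := by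
          rw [← Finset.mul_sum, ← Finset.sum_mul, sum_outQ_eq_one]
          ring
  refine le_trans ?_ (add_le_add_right hprod _)
  rw [← sum_joint_eq_one p W e, srcPr_eq_sum_joint p W e]
  unfold jointPr
  simp only [← Finset.sum_sub_distrib, ← Finset.sum_add_distrib]
  refine Finset.sum_le_sum fun s _ => Finset.sum_le_sum fun y _ => ?_
  classical
  have hw : 0 ≤ (p s * W (e s) y).toReal := ENNReal.toReal_nonneg
  have hprod_nonneg : 0 ≤ (p s).toReal * (outQ p W e y * 2 ^ ((n : ℝ) * r)) :=
    mul_nonneg ENNReal.toReal_nonneg (mul_nonneg (outQ_nonneg p W e y) (by positivity))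
  have hcm := joint_le_of_infoDensity_le p W e hn (r := r) (s := s) (y := y)
  simp only [Set.indicator_apply, Set.mem_ofPred_eq, Set.mem_compl_iff, ite_mul, zero_mul,
    ← ENNReal.toReal_mul]
  by_cases h₁ : infoDensity n p W e s y ≤ r <;> by_cases h₂ : d s (g y) ≤ α <;>
    by_cases h₃ : s ∈ A <;> simp [h₁, h₂, h₃] at hw hprod_nonneg hcm ⊢ <;> linarith

end JointLaw

/-- If the average distortion of a JSCC scheme for an SPO source is constantly `μ`,
but there is a fixed probability mass `ε₁` of distortion exceeding `μ + τ₁`, then there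
are `τ ∈ (0, μ)` and `ε > 0` such that for every `γ > 0` the liminf of
`P(iₙ(Sₙ,Yₙ) ≤ R(μ − τ) − γ)` is at most `1 − ε` (so reliable communication at rates
up to `R(μ − τ)` is possible with error probability bounded away from one). -/
theorem jscc_average_distortion_liminf
    (S X Y Sh : ℕ → Type)
    [∀ n, Fintype (S n)] [∀ n, Nonempty (S n)]
    [∀ n, Fintype (X n)] [∀ n, Nonempty (X n)]
    [∀ n, Fintype (Y n)] [∀ n, Nonempty (Y n)]
    [∀ n, Fintype (Sh n)] [∀ n, Nonempty (Sh n)]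
    (p : ∀ n, PMF (S n)) (W : ∀ n, X n → PMF (Y n))
    (e : ∀ n, S n → X n) (g : ∀ n, Y n → Sh n)
    (d : ∀ n, S n → Sh n → ℝ) (hd : ∀ n s sh, 0 ≤ d n s sh)
    -- SPO hypothesis
    (A : ∀ n, Set (S n)) (R : ℝ → ℝ) (k : ℕ → ℝ)
    (hk : Tendsto k atTop (nhds 0))
    (hA : Tendsto (fun n => srcPr (p n) (A n)ᶜ) atTop (nhds 0))
    (hSPO : ∀ n, 1 ≤ n → ∀ α : ℝ, 0 ≤ α → ∀ sh : Sh n,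
      srcPr (p n) {s | s ∈ A n ∧ d n s sh ≤ α} ≤ 2 ^ (-(n : ℝ) * (R α + k n)))
    -- the average distortion equals μ for all n, with 0 < μ < ∞
    (μ : ℝ) (hμpos : 0 < μ)
    (havg : ∀ n, 1 ≤ n → jointExp (p n) (W n) (e n) (g n) (d n) = μ)
    -- probability mass above the mean, uniformly in n
    (τ₁ ε₁ : ℝ) (hτ₁ : 0 < τ₁) (hε₁ : 0 < ε₁)
    (habove : ∀ n, 1 ≤ n →
      ε₁ < jointPr (p n) (W n) (e n) {sy | μ + τ₁ < d n sy.1 (g n sy.2)}) :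
    ∃ τ : ℝ, 0 < τ ∧ τ < μ ∧ ∃ ε : ℝ, 0 < ε ∧ ∀ γ : ℝ, 0 < γ →
      Filter.liminf
        (fun n => jointPr (p n) (W n) (e n)
          {sy | infoDensity n (p n) (W n) (e n) sy.1 sy.2 ≤ R (μ - τ) - γ})
        atTop ≤ 1 - ε := by
  set τ : ℝ := min (μ / 2) (ε₁ * τ₁ / 2) with hτ
  have hετ : 0 < ε₁ * τ₁ := mul_pos hε₁ hτ₁
  have hτpos : 0 < τ := lt_min (by linarith) (by linarith)
  have hτ_half : τ ≤ μ / 2 := min_le_left _ _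
  have hτ_le : τ ≤ ε₁ * τ₁ / 2 := min_le_right _ _
  set ε : ℝ := ε₁ * τ₁ / 2 / μ with hε
  have hlow : ∀ n, 1 ≤ n →
      ε ≤ jointPr (p n) (W n) (e n) {sy | d n sy.1 (g n sy.2) ≤ μ - τ} := by
    intro n hn
    have hmarkov := two_threshold_le_jointExp (p n) (W n) (e n) (g n) (d n) (hd n)
      (u := μ - τ) (v := μ + τ₁) (by linarith)
    rw [havg n hn] at hmarkov
    have hab := habove n hn
    have ha := jointPr_nonneg (p n) (W n) (e n) {sy | d n sy.1 (g n sy.2) ≤ μ - τ}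
    rw [hε, div_le_iff₀ hμpos]
    nlinarith
  refine ⟨τ, hτpos, by linarith, ε, by positivity, fun γ hγ => ?_⟩
  have hdecay : Tendsto (fun n : ℕ => (2 : ℝ) ^ (-((n : ℝ) * (γ + k n)))) atTop (nhds 0) := by
    have hlim : Tendsto (fun n => γ + k n) atTop (nhds γ) := by
      simpa using hk.const_add γ
    have hexp : Tendsto (fun n : ℕ => (n : ℝ) * (γ + k n)) atTop atTop :=
      tendsto_natCast_atTop_atTop.atTop_mul_pos hγ hlim
    exact (tendsto_rpow_atBot_of_base_gt_one 2 one_lt_two).comp (tendsto_neg_atTop_atBot.comp hexp)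
  have hbound : ∀ᶠ n in atTop, jointPr (p n) (W n) (e n)
      {sy | infoDensity n (p n) (W n) (e n) sy.1 sy.2 ≤ R (μ - τ) - γ}
      ≤ 1 - ε + srcPr (p n) (A n)ᶜ + (2 : ℝ) ^ (-((n : ℝ) * (γ + k n))) := by
    filter_upwards [eventually_ge_atTop 1] with n hn
    have hone := jointPr_infoDensity_le (p n) (W n) (e n) (g n) (d n) (A n) hn
      (r := R (μ - τ) - γ) (hSPO n hn (μ - τ) (by linarith))
    rw [← Real.rpow_add two_pos, show (n : ℝ) * (R (μ - τ) - γ) + -(n : ℝ) * (R (μ - τ) + k n)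
      = -((n : ℝ) * (γ + k n)) by ring] at hone
    linarith [hlow n hn]
  have hlim : Tendsto (fun n => 1 - ε + srcPr (p n) (A n)ᶜ + (2 : ℝ) ^ (-((n : ℝ) * (γ + k n))))
      atTop (nhds (1 - ε)) := by
    simpa using (hA.const_add (1 - ε)).add hdecay
  rw [← hlim.liminf_eq]
  exact liminf_le_liminf hbound
    (isBoundedUnder_of ⟨0, fun n => jointPr_nonneg _ _ _ _⟩) hlim.isCoboundedUnder_ge
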